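/- Let q ≥ 3 be an odd natural number, write q = 2k + 1, let θ ∈ (0, π), and set C = X(θ) * D ∈ SU(2). Then the two equations C^k * X(θ) * C^(-k) = D and C^k * (X(θ) * D * X(θ)⁻¹) * C^(-k) = X(θ) hold simultaneously if and only if θ = 2πj/q for some integer j with 1 ≤ j ≤ (q-1)/2. In particular the set of such θ in (0, π) has exactly (q-1)/2 elements. (These equations say that the pair (X(θ), D) is fixed by the action of the braid σ₁^q whose closure is the (2, q) torus knot, since σ₁^q sends (X₁, X₂) to (C^k X₁X₂X₁⁻¹ C^(-k), C^k X₁ C^(-k)) with C = X₁X₂.) -/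

import Mathlib

/-- The matrix `X(θ) = ![![i cos θ, sin θ], ![-sin θ, -i cos θ]]`. -/
noncomputable def Xθ (θ : ℝ) : Matrix (Fin 2) (Fin 2) ℂ :=
  !![Complex.I * (Real.cos θ : ℂ), (Real.sin θ : ℂ);
     -(Real.sin θ : ℂ), -(Complex.I * (Real.cos θ : ℂ))]

/-- The diagonal matrix `D = ![![i, 0], ![0, -i]]`. -/
def Dmat : Matrix (Fin 2) (Fin 2) ℂ := !![Complex.I, 0; 0, -Complex.I]

theorem det_Xθ (θ : ℝ) : (Xθ θ).det = 1 := by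
  have h : (Complex.sin θ) ^ 2 + (Complex.cos θ) ^ 2 = 1 := Complex.sin_sq_add_cos_sq _
  simp only [Xθ, Matrix.det_fin_two_of, Complex.ofReal_cos, Complex.ofReal_sin]
  linear_combination h - Complex.cos θ ^ 2 * Complex.I_sq

theorem Xθ_zero : Xθ 0 = Dmat := by
  simp [Xθ, Dmat]

theorem det_Xθ_mul_Dmat (θ : ℝ) : (Xθ θ * Dmat).det = 1 := by
  rw [Matrix.det_mul, ← Xθ_zero, det_Xθ, det_Xθ, one_mul]

/-- Conjugation by `X(θ) D` rotates the angle by `2θ`. -/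
theorem semiconjBy_Xθ_mul_Dmat (θ φ : ℝ) :
    SemiconjBy (Xθ θ * Dmat) (Xθ φ) (Xθ (φ + 2 * θ)) := by
  have left_mul : Xθ θ * Dmat * Xθ φ = -Xθ (φ + θ) := by
    ext i j
    fin_cases i <;> fin_cases j <;>
      simp [Xθ, Dmat, Matrix.mul_apply, Fin.sum_univ_two, Complex.cos_add, Complex.sin_add] <;>
      grind [Complex.I_mul_I]
  have right_mul (ψ : ℝ) : Xθ (ψ + θ) * (Xθ θ * Dmat) = -Xθ ψ := by
    have h : (Complex.sin θ) ^ 2 + (Complex.cos θ) ^ 2 = 1 := Complex.sin_sq_add_cos_sq _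
    ext i j
    fin_cases i <;> fin_cases j <;>
      simp [Xθ, Dmat, Matrix.mul_apply, Fin.sum_univ_two, Complex.cos_add, Complex.sin_add] <;>
      grind [Complex.I_mul_I]
  rw [SemiconjBy, left_mul, ← right_mul, add_assoc, two_mul]

theorem conj_pow_Xθ (θ φ : ℝ) (k : ℕ) :
    (Xθ θ * Dmat) ^ k * Xθ φ * ((Xθ θ * Dmat) ^ k)⁻¹ = Xθ (φ + 2 * k * θ) := by
  have semiconj : SemiconjBy ((Xθ θ * Dmat) ^ k) (Xθ φ) (Xθ (φ + 2 * k * θ)) := by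
    induction k with
    | zero => simp
    | succ k ih =>
      rw [pow_succ']
      have angle : φ + 2 * (k + 1 : ℕ) * θ = φ + 2 * k * θ + 2 * θ := by push_cast; ring
      rw [angle]
      exact (semiconjBy_Xθ_mul_Dmat θ _).mul_left ih
  rw [semiconj.eq]
  refine Matrix.mul_nonsing_inv_cancel_right _ _ ?_
  rw [Matrix.det_pow, det_Xθ_mul_Dmat, one_pow]
  exact isUnit_one

theorem conj_Dmat (θ : ℝ) : Xθ θ * Dmat * (Xθ θ)⁻¹ = Xθ (2 * θ) := by
  have semiconj : Xθ θ * Dmat = Xθ (2 * θ) * Xθ θ := by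
    have h := (semiconjBy_Xθ_mul_Dmat θ 0).eq
    rw [zero_add, Xθ_zero, ← mul_assoc] at h
    have hD : IsUnit Dmat.det := by simp [← Xθ_zero, det_Xθ]
    exact ((Matrix.isUnit_iff_isUnit_det _).2 hD).mul_right_cancel h
  rw [semiconj]
  exact Matrix.mul_nonsing_inv_cancel_right _ _ (by simp [det_Xθ])

theorem Xθ_eq_iff (φ ψ : ℝ) : Xθ φ = Xθ ψ ↔ ∃ n : ℤ, φ - ψ = 2 * Real.pi * n := by
  rw [← Real.Angle.angle_eq_iff_two_pi_dvd_sub]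
  constructor
  · intro h
    refine Real.Angle.cos_sin_inj ?_ ?_
    · have := congrFun (congrFun h 0) 0
      simpa [Xθ, ← Complex.ofReal_cos] using this
    · have := congrFun (congrFun h 0) 1
      simpa [Xθ, ← Complex.ofReal_sin] using this
  · intro h
    have hc : Real.cos φ = Real.cos ψ := by rw [← Real.Angle.cos_coe, h, Real.Angle.cos_coe]
    have hs : Real.sin φ = Real.sin ψ := by rw [← Real.Angle.sin_coe, h, Real.Angle.sin_coe]
    rw [Xθ, Xθ, hc, hs]

/-- The fixed-point equations say exactly that `(2k + 1)θ` is a multiple of `2π`. -/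
theorem fixed_point_iff (θ : ℝ) (k : ℕ) :
    ((Xθ θ * Dmat) ^ k * Xθ θ * ((Xθ θ * Dmat) ^ k)⁻¹ = Dmat ∧
      (Xθ θ * Dmat) ^ k * (Xθ θ * Dmat * (Xθ θ)⁻¹) * ((Xθ θ * Dmat) ^ k)⁻¹ = Xθ θ) ↔
    ∃ n : ℤ, (2 * k + 1) * θ = 2 * Real.pi * n := by
  rw [conj_Dmat, conj_pow_Xθ, conj_pow_Xθ, ← Xθ_zero, Xθ_eq_iff, Xθ_eq_iff,
    show θ + 2 * k * θ - 0 = (2 * k + 1) * θ by ring,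
    show 2 * θ + 2 * k * θ - θ = (2 * k + 1) * θ by ring, and_self]

theorem exists_int_mul_eq_iff (k : ℕ) {θ : ℝ} (hθ : θ ∈ Set.Ioo 0 Real.pi) :
    (∃ n : ℤ, (2 * k + 1) * θ = 2 * Real.pi * n) ↔
      ∃ j : ℕ, 1 ≤ j ∧ j ≤ k ∧ θ = 2 * Real.pi * j / (2 * k + 1) := by
  have hk : (0 : ℝ) < 2 * k + 1 := by positivity
  constructor
  · rintro ⟨n, hn⟩
    have n_pos : 0 < n := by
      have : 0 < 2 * Real.pi * n := hn ▸ mul_pos hk hθ.1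
      exact_mod_cast pos_of_mul_pos_right this Real.two_pi_pos.le
    have n_lt : 2 * n < 2 * k + 1 := by
      have : Real.pi * (2 * n) < Real.pi * (2 * k + 1) := by
        nlinarith [mul_lt_mul_of_pos_left hθ.2 hk]
      exact_mod_cast lt_of_mul_lt_mul_left this Real.pi_pos.le
    lift n to ℕ using n_pos.le
    refine ⟨n, by omega, by omega, ?_⟩
    rw [eq_div_iff hk.ne', mul_comm]
    exact_mod_cast hn
  · rintro ⟨j, -, -, rfl⟩
    exact ⟨j, by push_cast; field_simp⟩

theorem two_pi_mul_div_mem_Ioo {j k : ℕ} (hj : 1 ≤ j) (hjk : j ≤ k) :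
    2 * Real.pi * j / (2 * k + 1) ∈ Set.Ioo 0 Real.pi := by
  have j_pos : (0 : ℝ) < j := by exact_mod_cast hj
  have k_ge : (j : ℝ) ≤ k := by exact_mod_cast hjk
  refine ⟨by positivity, ?_⟩
  rw [div_lt_iff₀ (by positivity)]
  nlinarith [Real.pi_pos]

/-- Fixed-point equations for the `(2, q)` torus knot braid `σ₁^q` (`q = 2k + 1 ≥ 3` odd):
for `θ ∈ (0, π)` and `C = X(θ) D`, the equations `Cᵏ X(θ) C⁻ᵏ = D` and
`Cᵏ (X(θ) D X(θ)⁻¹) C⁻ᵏ = X(θ)` hold simultaneously iff `θ = 2πj/q` for some integer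
`1 ≤ j ≤ (q-1)/2`; in particular the set of such `θ` in `(0, π)` has exactly `(q-1)/2`
elements. -/
theorem torus_knot_fixed_points (q k : ℕ) (hq : q = 2 * k + 1) (hq3 : 3 ≤ q) :
    (∀ θ ∈ Set.Ioo (0 : ℝ) Real.pi,
      ((Xθ θ * Dmat) ^ k * Xθ θ * ((Xθ θ * Dmat) ^ k)⁻¹ = Dmat ∧
        (Xθ θ * Dmat) ^ k * (Xθ θ * Dmat * (Xθ θ)⁻¹) * ((Xθ θ * Dmat) ^ k)⁻¹ = Xθ θ) ↔
      ∃ j : ℕ, 1 ≤ j ∧ j ≤ (q - 1) / 2 ∧ θ = 2 * Real.pi * j / q) ∧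
    {θ : ℝ | θ ∈ Set.Ioo (0 : ℝ) Real.pi ∧
      (Xθ θ * Dmat) ^ k * Xθ θ * ((Xθ θ * Dmat) ^ k)⁻¹ = Dmat ∧
      (Xθ θ * Dmat) ^ k * (Xθ θ * Dmat * (Xθ θ)⁻¹) * ((Xθ θ * Dmat) ^ k)⁻¹ =
        Xθ θ}.ncard = (q - 1) / 2 := by
  have half : (q - 1) / 2 = k := by omega
  have cast_q : (q : ℝ) = 2 * k + 1 := by exact_mod_cast hq
  rw [half, cast_q]
  have solutions (θ : ℝ) (hθ : θ ∈ Set.Ioo 0 Real.pi) :=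
    (fixed_point_iff θ k).trans (exists_int_mul_eq_iff k hθ)
  refine ⟨solutions, ?_⟩
  have image_eq : {θ : ℝ | θ ∈ Set.Ioo (0 : ℝ) Real.pi ∧
      (Xθ θ * Dmat) ^ k * Xθ θ * ((Xθ θ * Dmat) ^ k)⁻¹ = Dmat ∧
      (Xθ θ * Dmat) ^ k * (Xθ θ * Dmat * (Xθ θ)⁻¹) * ((Xθ θ * Dmat) ^ k)⁻¹ = Xθ θ} =
      Set.image (fun j : ℕ ↦ 2 * Real.pi * j / (2 * k + 1)) (Finset.Icc 1 k) := by
    ext θ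
    simp only [Set.mem_ofPred_eq, Set.mem_image, Finset.coe_Icc, Set.mem_Icc]
    constructor
    · rintro ⟨hθ, h⟩
      obtain ⟨j, hj, hjk, rfl⟩ := (solutions θ hθ).1 h
      exact ⟨j, ⟨hj, hjk⟩, rfl⟩
    · rintro ⟨j, ⟨hj, hjk⟩, rfl⟩
      have hθ := two_pi_mul_div_mem_Ioo hj hjk
      exact ⟨hθ, (solutions _ hθ).2 ⟨j, hj, hjk, rfl⟩⟩
  have injective : Function.Injective fun j : ℕ ↦ 2 * Real.pi * j / (2 * k + 1) := by
    intro i j h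
    have hk : (2 * k + 1 : ℝ) ≠ 0 := by positivity
    simpa [div_left_inj' hk, Real.pi_ne_zero] using h
  rw [image_eq, Set.ncard_image_of_injective _ injective, Set.ncard_coe_finset, Nat.card_Icc,
    Nat.add_sub_cancel]
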